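/- arXiv:1609.08235 — 4 statements merged into one kernel-verified Lean document; each statement's English description precedes it below -/
import Mathlib

section
/- Let φ(x) = (2π)^(−1/2) exp(−x²/2) denote the standard normal density and Φ(x) = ∫_{−∞}^x φ(t) dt the standard normal CDF. For all real numbers α < β, the inequality (φ(α) − φ(β))² ≥ (α φ(α) − β φ(β)) · (Φ(β) − Φ(α)) holds. (This is the key inequality establishing positive semidefiniteness of the Hessian of the Probit per-entry negative log-likelihood.) -/
open MeasureTheory

/-- The standard normal density `φ(x) = (2π)^(−1/2) exp(−x²/2)`. -/
noncomputable def stdNormalPDF (x : ℝ) : ℝ :=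
  (Real.sqrt (2 * Real.pi))⁻¹ * Real.exp (-x ^ 2 / 2)

/-- The standard normal CDF `Φ(x) = ∫_{−∞}^x φ(t) dt`. -/
noncomputable def stdNormalCDF (x : ℝ) : ℝ :=
  ∫ t in Set.Iic x, stdNormalPDF t

theorem continuous_stdNormalPDF : Continuous stdNormalPDF := by
  unfold stdNormalPDF
  fun_prop

theorem stdNormalPDF_nonneg (x : ℝ) : 0 ≤ stdNormalPDF x := by
  unfold stdNormalPDF
  positivity

theorem integrable_stdNormalPDF : Integrable stdNormalPDF := by
  have h := (integrable_exp_neg_mul_sq (b := 1 / 2) (by norm_num)).const_mul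
    (Real.sqrt (2 * Real.pi))⁻¹
  refine h.congr (Filter.Eventually.of_forall fun x => ?_)
  simp only [stdNormalPDF]
  ring_nf

theorem hasDerivAt_stdNormalPDF (x : ℝ) :
    HasDerivAt stdNormalPDF (-(x * stdNormalPDF x)) x := by
  have h : HasDerivAt (fun y : ℝ => -y ^ 2 / 2) (-x) x := by
    refine ((hasDerivAt_pow 2 x).neg.div_const 2).congr_deriv ?_
    norm_num
    ring
  refine (h.exp.const_mul (Real.sqrt (2 * Real.pi))⁻¹).congr_deriv ?_
  simp only [stdNormalPDF]
  ring

theorem stdNormalCDF_sub (α β : ℝ) :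
    stdNormalCDF β - stdNormalCDF α = ∫ t in α..β, stdNormalPDF t :=
  intervalIntegral.integral_Iic_sub_Iic integrable_stdNormalPDF.integrableOn
    integrable_stdNormalPDF.integrableOn

theorem integral_id_mul_stdNormalPDF (α β : ℝ) :
    ∫ t in α..β, t * stdNormalPDF t = stdNormalPDF α - stdNormalPDF β := by
  have h := intervalIntegral.integral_eq_sub_of_hasDerivAt (a := α) (b := β)
    (fun x _ => hasDerivAt_stdNormalPDF x)
    ((continuous_id.mul continuous_stdNormalPDF).neg.intervalIntegrable α β)
  rw [intervalIntegral.integral_neg] at h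
  linarith

theorem mul_stdNormalCDF_sub_le {α β : ℝ} (h : α ≤ β) :
    α * (stdNormalCDF β - stdNormalCDF α) ≤ stdNormalPDF α - stdNormalPDF β := by
  rw [stdNormalCDF_sub, ← integral_id_mul_stdNormalPDF, ← intervalIntegral.integral_const_mul]
  exact intervalIntegral.integral_mono_on h
    ((continuous_stdNormalPDF.const_mul α).intervalIntegrable α β)
    ((continuous_id.mul continuous_stdNormalPDF).intervalIntegrable α β)
    fun t ht => mul_le_mul_of_nonneg_right ht.1 (stdNormalPDF_nonneg t)

theorem le_mul_stdNormalCDF_sub {α β : ℝ} (h : α ≤ β) :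
    stdNormalPDF α - stdNormalPDF β ≤ β * (stdNormalCDF β - stdNormalCDF α) := by
  rw [stdNormalCDF_sub, ← integral_id_mul_stdNormalPDF, ← intervalIntegral.integral_const_mul]
  exact intervalIntegral.integral_mono_on h
    ((continuous_id.mul continuous_stdNormalPDF).intervalIntegrable α β)
    ((continuous_stdNormalPDF.const_mul β).intervalIntegrable α β)
    fun t ht => mul_le_mul_of_nonneg_right ht.2 (stdNormalPDF_nonneg t)

/-- Key inequality for positive semidefiniteness of the Probit Hessian:
`(φ(α) − φ(β))² ≥ (α φ(α) − β φ(β)) (Φ(β) − Φ(α))` for `α < β`. -/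
theorem stdNormal_probit_hessian_ineq (α β : ℝ) (hαβ : α < β) :
    (stdNormalPDF α - stdNormalPDF β) ^ 2
      ≥ (α * stdNormalPDF α - β * stdNormalPDF β) * (stdNormalCDF β - stdNormalCDF α) := by
  have hα := mul_le_mul_of_nonneg_left (mul_stdNormalCDF_sub_le hαβ.le) (stdNormalPDF_nonneg α)
  have hβ := mul_le_mul_of_nonneg_left (le_mul_stdNormalCDF_sub hαβ.le) (stdNormalPDF_nonneg β)
  linarith
end

section
/- Let E be a real inner product space and ρ > 0. Suppose F : E → ℝ is ρ-strongly convex and attains its minimum at x₀, G : E → ℝ is ρ-strongly convex and attains its minimum at y₀, and the difference F − G is K-Lipschitz on E for some K ≥ 0. Then ‖x₀ − y₀‖ ≤ K/ρ. (Stability of minimizers of strongly convex functions; this is the core of the Lemma bounding the distance between successive subspace estimates.) -/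
open RealInnerProductSpace

/-- A strongly convex function grows at least quadratically away from a minimizer. -/
theorem StrongConvexOn.add_sq_norm_sub_le_of_isMinOn {E : Type*} [NormedAddCommGroup E]
    [NormedSpace ℝ E] {s : Set E} {m : ℝ} {f : E → ℝ} {x₀ x : E} (hf : StrongConvexOn s m f)
    (hmin : IsMinOn f s x₀) (hx₀ : x₀ ∈ s) (hx : x ∈ s) :
    f x₀ + m / 2 * ‖x₀ - x‖ ^ 2 ≤ f x := by
  have hd : f x₀ ≤ f x := hmin hx
  have key : ∀ a : ℝ, 0 ≤ a → a < 1 → a * (m / 2 * ‖x₀ - x‖ ^ 2) ≤ f x - f x₀ := by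
    intro a ha ha'
    have hb : 0 < 1 - a := sub_pos.2 ha'
    have h := hf.2 hx₀ hx ha hb.le (add_sub_cancel a 1)
    have hle : f x₀ ≤ f (a • x₀ + (1 - a) • x) :=
      hmin (hf.1 hx₀ hx ha hb.le (add_sub_cancel a 1))
    simp only [smul_eq_mul] at h
    refine le_of_mul_le_mul_left ?_ hb
    linarith
  by_contra! hlt
  set c := m / 2 * ‖x₀ - x‖ ^ 2
  have hc : 0 < c := by linarith
  have h := key ((f x - f x₀ + c) / (2 * c)) (by apply div_nonneg <;> linarith)
    (by rw [div_lt_one (by positivity)]; linarith)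
  have e : (f x - f x₀ + c) / (2 * c) * c = (f x - f x₀ + c) / 2 := by field_simp
  linarith

/-- Stability of minimizers of strongly convex functions: if `F` and `G` are
`ρ`-strongly convex with minimizers `x₀` and `y₀` respectively, and `F − G` is
`K`-Lipschitz, then `‖x₀ − y₀‖ ≤ K/ρ`. -/
theorem strongly_convex_minimizer_stability {E : Type*} [NormedAddCommGroup E]
    [InnerProductSpace ℝ E] (ρ : ℝ) (hρ : 0 < ρ) (K : ℝ) (hK : 0 ≤ K) (F G : E → ℝ)
    (x₀ y₀ : E)
    (hF : ConvexOn ℝ Set.univ (fun x => F x - (ρ / 2) * ‖x‖ ^ 2))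
    (hG : ConvexOn ℝ Set.univ (fun x => G x - (ρ / 2) * ‖x‖ ^ 2))
    (hx₀ : ∀ x, F x₀ ≤ F x) (hy₀ : ∀ x, G y₀ ≤ G x)
    (hLip : ∀ x y, |(F x - G x) - (F y - G y)| ≤ K * ‖x - y‖) :
    ‖x₀ - y₀‖ ≤ K / ρ := by
  have hF' := (strongConvexOn_iff_convex.2 hF).add_sq_norm_sub_le_of_isMinOn
    (fun x _ => hx₀ x) (Set.mem_univ x₀) (Set.mem_univ y₀)
  have hG' := (strongConvexOn_iff_convex.2 hG).add_sq_norm_sub_le_of_isMinOn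
    (fun x _ => hy₀ x) (Set.mem_univ y₀) (Set.mem_univ x₀)
  rw [norm_sub_rev y₀ x₀] at hG'
  have hL := (abs_le.1 (hLip x₀ y₀)).1
  rw [le_div_iff₀ hρ]
  rcases (norm_nonneg (x₀ - y₀)).eq_or_lt with h | h
  · rwa [← h, zero_mul]
  · refine le_of_mul_le_mul_right ?_ h
    linarith
end

section
/- Let E be a real inner product space, T ≥ 1 a natural number, μ > 0, and B ≥ 0. Let g_1, …, g_T : E → ℝ be convex differentiable functions, and let U_0, U_1, …, U_T ∈ E be generated by the gradient iteration U_t = U_{t−1} − μ ∇g_t(U_{t−1}) for t = 1, …, T. Assume that ‖U_t − U_{t−1}‖ ≤ B/t for every t = 1, …, T. Then the online regret, defined as R_T = (1/T) Σ_{t=1}^T g_t(U_{t−1}) − (1/T) Σ_{t=1}^T g_t(U_T), satisfies R_T ≤ B² (ln T + 1)² / (2 μ T) + 5 B² / (6 μ T). In particular the regret is sublinear: R_T → 0 as T → ∞. (Regret bound for the online categorical subspace learning iterates with constant step size.) -/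
open RealInnerProductSpace

/-- First-order condition for convexity, in gradient form. -/
lemma ConvexOn.inner_gradient_le_sub {E : Type*} [NormedAddCommGroup E] [InnerProductSpace ℝ E]
    [CompleteSpace E] {f : E → ℝ} (hf : ConvexOn ℝ Set.univ f) {x : E}
    (hd : DifferentiableAt ℝ f x) (y : E) :
    inner ℝ (gradient f x) (y - x) ≤ f y - f x := by
  have hline : HasDerivAt (fun s : ℝ => f (AffineMap.lineMap x y s))
      (inner ℝ (gradient f x) (y - x)) 0 := by
    have hg : HasFDerivAt f (InnerProductSpace.toDual ℝ E (gradient f x))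
        (AffineMap.lineMap x y (0 : ℝ)) := by
      rw [AffineMap.lineMap_apply_zero]
      exact hd.hasGradientAt.hasFDerivAt
    simpa [Function.comp_def] using
      hg.comp_hasDerivAt (0 : ℝ) (AffineMap.hasDerivAt_lineMap (a := x) (b := y))
  have hc : ConvexOn ℝ Set.univ (fun s : ℝ => f (AffineMap.lineMap x y s)) :=
    hf.comp_affineMap (AffineMap.lineMap x y)
  simpa [slope_def_field] using
    hc.le_slope_of_hasDerivAt (Set.mem_univ 0) (Set.mem_univ 1) one_pos hline

/-- The partial sums of the Basel series are at most `5 / 3`. -/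
lemma sum_range_one_div_succ_sq_le (n : ℕ) :
    ∑ t ∈ Finset.range n, 1 / ((t : ℝ) + 1) ^ 2 ≤ 5 / 3 := by
  have hsharp (m : ℕ) : ∑ t ∈ Finset.range (m + 1), 1 / ((t : ℝ) + 1) ^ 2
      ≤ 5 / 3 - 1 / ((m : ℝ) + 3 / 2) := by
    induction m with
    | zero => norm_num
    | succ m ih =>
      rw [Finset.sum_range_succ]
      have hm : (0 : ℝ) ≤ m := m.cast_nonneg
      have key : 1 / ((m : ℝ) + 1 + 1) ^ 2
          ≤ 1 / ((m : ℝ) + 3 / 2) - 1 / ((m : ℝ) + 1 + 3 / 2) := by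
        rw [div_sub_div _ _ (by positivity) (by positivity),
          div_le_div_iff₀ (by positivity) (by positivity)]
        nlinarith
      push_cast
      linarith
  cases n with
  | zero => norm_num
  | succ m =>
    have : 0 ≤ 1 / ((m : ℝ) + 3 / 2) := by positivity
    linarith [hsharp m]

/-- The identity behind the analysis of a gradient step `v = u - μ • d`. -/
lemma inner_sub_eq_of_eq_sub_smul {E : Type*} [NormedAddCommGroup E] [InnerProductSpace ℝ E]
    {μ : ℝ} (hμ : μ ≠ 0) {u v d : E} (h : v = u - μ • d) (w : E) :
    inner ℝ d (u - w) = (‖u - w‖ ^ 2 - ‖v - w‖ ^ 2 + ‖v - u‖ ^ 2) / (2 * μ) := by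
  have h1 : v - w = (u - w) - μ • d := by rw [h]; abel
  have h2 : v - u = -(μ • d) := by rw [h]; abel
  rw [h1, h2, norm_neg, norm_sub_sq_real (u - w), real_inner_smul_right, real_inner_comm]
  field_simp
  ring

/-- Regret bound for online iterates with constant step size: if the convex
differentiable losses `g_t` generate iterates `U_t = U_{t−1} − μ ∇g_t(U_{t−1})` with
`‖U_t − U_{t−1}‖ ≤ B/t` for `t = 1, …, T`, then the online regret
`R_T = (1/T) Σ_t g_t(U_{t−1}) − (1/T) Σ_t g_t(U_T)` satisfies
`R_T ≤ B²(ln T + 1)²/(2μT) + 5B²/(6μT)`. -/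
theorem online_regret_bound {E : Type*} [NormedAddCommGroup E] [InnerProductSpace ℝ E]
    [CompleteSpace E] (T : ℕ) (hT : 1 ≤ T) (μ B : ℝ) (hμ : 0 < μ) (hB : 0 ≤ B)
    (g : ℕ → E → ℝ) (U : ℕ → E)
    (hconv : ∀ t : ℕ, 1 ≤ t → t ≤ T → ConvexOn ℝ Set.univ (g t))
    (hdiff : ∀ t : ℕ, 1 ≤ t → t ≤ T → Differentiable ℝ (g t))
    (hupd : ∀ t : ℕ, 1 ≤ t → t ≤ T → U t = U (t - 1) - μ • gradient (g t) (U (t - 1)))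
    (hstep : ∀ t : ℕ, 1 ≤ t → t ≤ T → ‖U t - U (t - 1)‖ ≤ B / t) :
    (1 / (T : ℝ)) * ∑ t ∈ Finset.Icc 1 T, g t (U (t - 1))
        - (1 / (T : ℝ)) * ∑ t ∈ Finset.Icc 1 T, g t (U T)
      ≤ B ^ 2 * (Real.log T + 1) ^ 2 / (2 * μ * T) + 5 * B ^ 2 / (6 * μ * T) := by
  have hTpos : (0 : ℝ) < T := by exact_mod_cast hT
  have hshift (f : ℕ → ℝ) :
      ∑ t ∈ Finset.Icc 1 T, f t = ∑ t ∈ Finset.range T, f (t + 1) := by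
    rw [Finset.range_eq_Ico, Finset.sum_Ico_add' f 0 T 1]
    rfl
  have hstep' (t : ℕ) (ht : t < T) : ‖U (t + 1) - U t‖ ≤ B / ((t : ℝ) + 1) := by
    simpa using hstep (t + 1) (by lia) (by lia)
  have hterm (t : ℕ) (ht : t < T) : g (t + 1) (U t) - g (t + 1) (U T)
      ≤ ((‖U t - U T‖ ^ 2 - ‖U (t + 1) - U T‖ ^ 2)
        + B ^ 2 * (1 / ((t : ℝ) + 1) ^ 2)) / (2 * μ) := by
    have hc := (hconv (t + 1) (by lia) (by lia)).inner_gradient_le_sub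
      (hdiff (t + 1) (by lia) (by lia) (U t)) (U T)
    have hid := inner_sub_eq_of_eq_sub_smul hμ.ne' (hupd (t + 1) (by lia) (by lia)) (U T)
    rw [Nat.add_sub_cancel] at hid
    rw [← neg_sub (U t) (U T), inner_neg_right, hid] at hc
    have hsq : ‖U (t + 1) - U t‖ ^ 2 ≤ B ^ 2 * (1 / ((t : ℝ) + 1) ^ 2) := by
      calc ‖U (t + 1) - U t‖ ^ 2 ≤ (B / ((t : ℝ) + 1)) ^ 2 := by gcongr; exact hstep' t ht
        _ = _ := by rw [div_pow, mul_one_div]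
    refine le_trans (by linarith) (div_le_div_of_nonneg_right
      (add_le_add_right hsq (‖U t - U T‖ ^ 2 - ‖U (t + 1) - U T‖ ^ 2)) (by positivity))
  have hdist : ‖U 0 - U T‖ ≤ B * (Real.log T + 1) := by
    calc ‖U 0 - U T‖ ≤ ∑ t ∈ Finset.range T, B / ((t : ℝ) + 1) := by
          rw [← dist_eq_norm]
          refine dist_le_range_sum_of_dist_le T fun {t} ht => ?_
          rw [dist_comm, dist_eq_norm]
          exact hstep' t ht
      _ = B * (harmonic T : ℝ) := by
          simp [harmonic, Finset.mul_sum, div_eq_mul_inv]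
      _ ≤ B * (Real.log T + 1) := by
          gcongr
          linarith [harmonic_le_one_add_log T]
  have hsum : ∑ t ∈ Finset.range T, (g (t + 1) (U t) - g (t + 1) (U T))
      ≤ (B ^ 2 * (Real.log T + 1) ^ 2 + B ^ 2 * (5 / 3)) / (2 * μ) := by
    refine (Finset.sum_le_sum fun t ht => hterm t (Finset.mem_range.mp ht)).trans ?_
    rw [← Finset.sum_div, Finset.sum_add_distrib, ← Finset.mul_sum,
      Finset.sum_range_sub' (fun t => ‖U t - U T‖ ^ 2), sub_self, norm_zero, ← mul_pow]
    have hsq : ‖U 0 - U T‖ ^ 2 ≤ (B * (Real.log T + 1)) ^ 2 := by gcongr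
    gcongr
    · linarith
    · exact sum_range_one_div_succ_sq_le T
  rw [← mul_sub, ← Finset.sum_sub_distrib, hshift]
  simp only [Nat.add_sub_cancel]
  calc _ ≤ 1 / (T : ℝ) * ((B ^ 2 * (Real.log T + 1) ^ 2 + B ^ 2 * (5 / 3)) / (2 * μ)) := by
        gcongr
    _ = _ := by
        field_simp
        ring
end

section
/- Let E be a real inner product space, T ≥ 1 a natural number, μ > 0, and B ≥ 0. Let g_1, …, g_T : E → ℝ be differentiable functions and U_0, …, U_T ∈ E satisfy U_t = U_{t−1} − μ ∇g_t(U_{t−1}) and ‖U_t − U_{t−1}‖ ≤ B/t for every t = 1, …, T. Then Σ_{t=1}^T ⟨U_{t−1} − U_T, ∇g_t(U_{t−1})⟩ ≤ ‖U_0 − U_T‖²/(2μ) + (B²/(2μ)) Σ_{t=1}^T 1/t². (Key telescoping bound in the regret analysis with constant step size.) -/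
open RealInnerProductSpace

/-- The inner product of `x - w` with the direction of a step `x ↦ x - μ • v`, in terms of the
squared distances to `w` before and after the step and the squared step length. -/
theorem inner_sub_eq_of_step {E : Type*} [NormedAddCommGroup E] [InnerProductSpace ℝ E]
    {μ : ℝ} (hμ : μ ≠ 0) {x y v : E} (w : E) (hy : y = x - μ • v) :
    ⟪x - w, v⟫ = (‖x - w‖ ^ 2 - ‖y - w‖ ^ 2) / (2 * μ) + ‖y - x‖ ^ 2 / (2 * μ) := by
  have hw : y - w = (x - w) - μ • v := by rw [hy]; abel
  have hx : y - x = -(μ • v) := by rw [hy]; abel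
  rw [hw, hx, norm_neg, norm_sub_sq_real (x - w), real_inner_smul_right]
  field_simp
  ring

/-- Telescoping bound for the steps `U t = U (t - 1) - μ • v t`, relative to an arbitrary
comparison point `w`. -/
theorem sum_inner_sub_le_of_step {E : Type*} [NormedAddCommGroup E] [InnerProductSpace ℝ E]
    {μ B : ℝ} (hμ : 0 < μ) (U v : ℕ → E) (w : E) (n : ℕ)
    (hupd : ∀ t : ℕ, 1 ≤ t → t ≤ n → U t = U (t - 1) - μ • v t)
    (hstep : ∀ t : ℕ, 1 ≤ t → t ≤ n → ‖U t - U (t - 1)‖ ≤ B / t) :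
    ∑ t ∈ Finset.Icc 1 n, ⟪U (t - 1) - w, v t⟫
      ≤ (‖U 0 - w‖ ^ 2 - ‖U n - w‖ ^ 2) / (2 * μ)
        + (B ^ 2 / (2 * μ)) * ∑ t ∈ Finset.Icc 1 n, (1 : ℝ) / (t : ℝ) ^ 2 := by
  induction n with
  | zero => simp
  | succ n ih =>
    specialize ih (fun t h₁ h₂ => hupd t h₁ (by lia)) (fun t h₁ h₂ => hstep t h₁ (by lia))
    have hn : 1 ≤ n + 1 := by lia
    have hlen : ‖U (n + 1) - U n‖ ^ 2 / (2 * μ)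
        ≤ (B ^ 2 / (2 * μ)) * (1 / ((n + 1 : ℕ) : ℝ) ^ 2) := by
      calc ‖U (n + 1) - U n‖ ^ 2 / (2 * μ)
          ≤ (B / ((n + 1 : ℕ) : ℝ)) ^ 2 / (2 * μ) := by
            gcongr
            exact hstep (n + 1) hn le_rfl
        _ = (B ^ 2 / (2 * μ)) * (1 / ((n + 1 : ℕ) : ℝ) ^ 2) := by ring
    have heq := inner_sub_eq_of_step hμ.ne' w (hupd (n + 1) hn le_rfl)
    rw [Finset.sum_Icc_succ_top hn, Finset.sum_Icc_succ_top hn, mul_add]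
    simp only [Nat.add_sub_cancel] at heq ⊢
    rw [heq, sub_div, sub_div]
    rw [sub_div] at ih
    linarith

/-- Key telescoping bound in the regret analysis with constant step size: if
`U_t = U_{t−1} − μ ∇g_t(U_{t−1})` and `‖U_t − U_{t−1}‖ ≤ B/t` for `t = 1, …, T`, then
`Σ_{t=1}^T ⟨U_{t−1} − U_T, ∇g_t(U_{t−1})⟩ ≤ ‖U_0 − U_T‖²/(2μ) + (B²/(2μ)) Σ_{t=1}^T 1/t²`. -/
theorem regret_telescoping_bound {E : Type*} [NormedAddCommGroup E] [InnerProductSpace ℝ E]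
    [CompleteSpace E] (T : ℕ) (hT : 1 ≤ T) (μ B : ℝ) (hμ : 0 < μ) (hB : 0 ≤ B)
    (g : ℕ → E → ℝ) (U : ℕ → E)
    (hdiff : ∀ t : ℕ, 1 ≤ t → t ≤ T → Differentiable ℝ (g t))
    (hupd : ∀ t : ℕ, 1 ≤ t → t ≤ T → U t = U (t - 1) - μ • gradient (g t) (U (t - 1)))
    (hstep : ∀ t : ℕ, 1 ≤ t → t ≤ T → ‖U t - U (t - 1)‖ ≤ B / t) :
    ∑ t ∈ Finset.Icc 1 T, ⟪U (t - 1) - U T, gradient (g t) (U (t - 1))⟫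
      ≤ ‖U 0 - U T‖ ^ 2 / (2 * μ)
        + (B ^ 2 / (2 * μ)) * ∑ t ∈ Finset.Icc 1 T, (1 : ℝ) / (t : ℝ) ^ 2 := by
  simpa using sum_inner_sub_le_of_step hμ U (fun t => gradient (g t) (U (t - 1))) (U T) T
    hupd hstep
end
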